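/- arXiv:2308.09902 — 8 statements merged into one kernel-verified Lean document; each statement's English description precedes it below -/
import Mathlib

section
/- Let σ > 0, μ, μ' ∈ ℝ, and let α > 1 be a real number. Then ∫_ℝ φ_{μ,σ²}(x)^α · φ_{μ',σ²}(x)^{1−α} dx = exp(α(α − 1)(μ − μ')²/(2σ²)). Equivalently, the Rényi divergence of order α between the Gaussian measures gaussianReal μ σ² and gaussianReal μ' σ² equals α(μ − μ')²/(2σ²), so the one-dimensional Gaussian mechanism with noise variance σ² applied to a query of sensitivity Δ ≥ |μ − μ'| satisfies (α, αΔ²/(2σ²))-Rényi differential privacy. -/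
open MeasureTheory ProbabilityTheory

/-- Rényi-divergence integral for one-dimensional Gaussians with common
variance `σ²`:
`∫ φ_{μ,σ²}(x)^α · φ_{μ',σ²}(x)^{1−α} dx = exp(α(α−1)(μ−μ')²/(2σ²))`. -/
theorem gaussian_renyi_integral (σ : NNReal) (hσ : 0 < σ) (μ μ' : ℝ)
    (α : ℝ) (hα : 1 < α) :
    ∫ x : ℝ, (gaussianPDFReal μ (σ ^ 2) x) ^ α * (gaussianPDFReal μ' (σ ^ 2) x) ^ (1 - α)
      = Real.exp (α * (α - 1) * (μ - μ') ^ 2 / (2 * (σ : ℝ) ^ 2)) := by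
  have hv : (σ ^ 2 : NNReal) ≠ 0 := pow_ne_zero _ hσ.ne'
  have hs : (σ : ℝ) ≠ 0 := by exact_mod_cast hσ.ne'
  have key : ∀ x : ℝ,
      (gaussianPDFReal μ (σ ^ 2) x) ^ α * (gaussianPDFReal μ' (σ ^ 2) x) ^ (1 - α)
        = Real.exp (α * (α - 1) * (μ - μ') ^ 2 / (2 * (σ : ℝ) ^ 2))
          * gaussianPDFReal (α * μ + (1 - α) * μ') (σ ^ 2) x := by
    intro x
    have hc : 0 < (Real.sqrt (2 * Real.pi * ((σ ^ 2 : NNReal) : ℝ)))⁻¹ := by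
      have : (0 : ℝ) < ((σ ^ 2 : NNReal) : ℝ) := by
        exact_mod_cast pow_pos hσ 2
      positivity
    simp only [gaussianPDFReal]
    set c := (Real.sqrt (2 * Real.pi * ((σ ^ 2 : NNReal) : ℝ)))⁻¹ with hcdef
    rw [Real.mul_rpow hc.le (Real.exp_pos _).le, Real.mul_rpow hc.le (Real.exp_pos _).le,
      ← Real.exp_mul, ← Real.exp_mul, mul_mul_mul_comm, ← Real.rpow_add hc, ← Real.exp_add,
      mul_left_comm, ← Real.exp_add]
    have h1 : α + (1 - α) = 1 := by ring
    rw [h1, Real.rpow_one]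
    congr 2
    push_cast
    field_simp
    ring
  simp_rw [key]
  rw [integral_const_mul, integral_gaussianPDFReal_eq_one _ hv, mul_one]
end

section
/- Let d ≥ 1, σ > 0, μ, μ' : Fin d → ℝ, and let α > 1 be a real number. Let P be the product measure on ℝ^d whose i-th factor is gaussianReal (μ i) σ², and let Q be the product measure whose i-th factor is gaussianReal (μ' i) σ². Then ∫ (dP/dQ)^α dQ = exp(α(α − 1) · ‖μ − μ'‖²/(2σ²)), where ‖μ − μ'‖² = Σ_i (μ i − μ' i)². Equivalently, the order-α Rényi divergence between the d-dimensional spherical Gaussians equals α‖μ − μ'‖²/(2σ²). -/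
open MeasureTheory ProbabilityTheory

noncomputable def gaussLR (a b v x : ℝ) : ℝ :=
  Real.exp ((a - b) / v * x + -((a ^ 2 - b ^ 2) / (2 * v)))

lemma measurable_gaussLR (a b v : ℝ) : Measurable (gaussLR a b v) := by
  unfold gaussLR
  fun_prop

lemma gaussianReal_eq_withDensity_LR (a b : ℝ) (v : NNReal) (hv : v ≠ 0) :
    gaussianReal a v
      = (gaussianReal b v).withDensity (fun x => ENNReal.ofReal (gaussLR a b v x)) := by
  have hv' : (v : ℝ) ≠ 0 := by exact_mod_cast hv
  rw [gaussianReal_of_var_ne_zero _ hv, gaussianReal_of_var_ne_zero _ hv,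
    ← withDensity_mul _ (measurable_gaussianPDF b v) (measurable_gaussLR a b v).ennreal_ofReal]
  congr 1
  ext x
  simp only [Pi.mul_apply, gaussianPDF]
  rw [← ENNReal.ofReal_mul (gaussianPDFReal_nonneg _ _ _)]
  congr 1
  simp only [gaussianPDFReal, gaussLR]
  rw [mul_assoc _ (Real.exp _), ← Real.exp_add]
  congr 2
  field_simp
  ring

lemma integral_gaussLR_rpow (a b : ℝ) (v : NNReal) (hv : v ≠ 0) (α : ℝ) :
    ∫ x, gaussLR a b v x ^ α ∂(gaussianReal b v)
      = Real.exp (α * (α - 1) * (a - b) ^ 2 / (2 * v)) := by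
  have hv' : (v : ℝ) ≠ 0 := by exact_mod_cast hv
  have h := congrFun (mgf_fun_id_gaussianReal (μ := b) (v := v)) ((a - b) / v * α)
  unfold mgf at h
  have : ∀ x, gaussLR a b v x ^ α
      = Real.exp ((a - b) / v * α * x) * Real.exp (-((a ^ 2 - b ^ 2) / (2 * v)) * α) := by
    intro x
    rw [gaussLR, ← Real.exp_mul, ← Real.exp_add]
    congr 1
    ring
  simp_rw [this]
  rw [integral_mul_const, h, ← Real.exp_add]
  congr 1
  field_simp
  ring

lemma pi_withDensity_prob {d : ℕ} (Q P : Fin d → Measure ℝ) [∀ i, IsProbabilityMeasure (Q i)]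
    [∀ i, SigmaFinite (P i)]
    (f : Fin d → ℝ → ENNReal) (hf : ∀ i, Measurable (f i))
    (h : ∀ i, P i = (Q i).withDensity (f i)) :
    Measure.pi P = (Measure.pi Q).withDensity (fun x => ∏ i, f i (x i)) := by
  refine Measure.pi_eq fun s hs => ?_
  have hg : ∀ i, Measurable ((s i).indicator (f i)) := fun i => (hf i).indicator (hs i)
  have hind := iIndepFun_pi (μ := Q) (X := fun i => (s i).indicator (f i))
    (fun i => (hg i).aemeasurable)
  have key := lintegral_prod_eq_prod_lintegral_of_indepFun Finset.univ _ hind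
    (fun i => (hg i).comp (measurable_pi_apply i))
  rw [withDensity_apply _ (MeasurableSet.univ_pi hs),
    ← lintegral_indicator (MeasurableSet.univ_pi hs)]
  refine Eq.trans (lintegral_congr fun x => ?_) (key.trans (Finset.prod_congr rfl fun i _ => ?_))
  · by_cases hx : x ∈ Set.univ.pi s
    · rw [Set.indicator_of_mem hx]
      refine Finset.prod_congr rfl fun i _ => ?_
      rw [Set.indicator_of_mem (hx i trivial)]
    · rw [Set.indicator_of_notMem hx]
      simp only [Set.mem_univ_pi, not_forall] at hx
      obtain ⟨i, hi⟩ := hx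
      exact (Finset.prod_eq_zero (Finset.mem_univ i) (Set.indicator_of_notMem hi _)).symm
  · rw [h i, withDensity_apply _ (hs i), ← lintegral_indicator (hs i)]
    exact (measurePreserving_eval Q i).lintegral_comp (hg i)

/-- Rényi-divergence integral for `d`-dimensional spherical Gaussians with common
variance `σ²`: letting `P = ⊗_i gaussianReal (μ i) σ²` and
`Q = ⊗_i gaussianReal (μ' i) σ²`, we have
`∫ (dP/dQ)^α dQ = exp(α(α−1)‖μ−μ'‖²/(2σ²))`. -/
theorem gaussian_pi_renyi_integral (d : ℕ) (hd : 1 ≤ d) (σ : NNReal) (hσ : 0 < σ)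
    (μ μ' : Fin d → ℝ) (α : ℝ) (hα : 1 < α) :
    ∫ x, (((Measure.pi fun i => gaussianReal (μ i) (σ ^ 2)).rnDeriv
          (Measure.pi fun i => gaussianReal (μ' i) (σ ^ 2))) x).toReal ^ α
        ∂(Measure.pi fun i => gaussianReal (μ' i) (σ ^ 2))
      = Real.exp (α * (α - 1) * (∑ i, (μ i - μ' i) ^ 2) / (2 * (σ : ℝ) ^ 2)) := by
  have hv : σ ^ 2 ≠ 0 := pow_ne_zero _ hσ.ne'
  have hm : ∀ i, Measurable fun x => ENNReal.ofReal (gaussLR (μ i) (μ' i) (σ ^ 2 : NNReal) x) :=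
    fun i => (measurable_gaussLR _ _ _).ennreal_ofReal
  have hP := pi_withDensity_prob (fun i => gaussianReal (μ' i) (σ ^ 2))
    (fun i => gaussianReal (μ i) (σ ^ 2)) _ hm
    (fun i => gaussianReal_eq_withDensity_LR (μ i) (μ' i) (σ ^ 2) hv)
  have hr := Measure.rnDeriv_withDensity (Measure.pi fun i => gaussianReal (μ' i) (σ ^ 2))
    (f := fun x : Fin d → ℝ => ∏ i, ENNReal.ofReal (gaussLR (μ i) (μ' i) (σ ^ 2 : NNReal) (x i)))
    (Finset.measurable_prod _ fun i _ => (hm i).comp (measurable_pi_apply i))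
  rw [← hP] at hr
  have hpos : ∀ i x, 0 ≤ gaussLR (μ i) (μ' i) (σ ^ 2 : NNReal) x := fun i x => (Real.exp_pos _).le
  have hc := integral_fintype_prod_eq_prod (μ := fun i => gaussianReal (μ' i) (σ ^ 2))
    (fun i x => gaussLR (μ i) (μ' i) (σ ^ 2 : NNReal) x ^ α)
  refine Eq.trans (integral_congr_ae ?_) (hc.trans ?_)
  · filter_upwards [hr] with x hx
    rw [hx, ENNReal.toReal_prod, ← Real.finsetProd_rpow _ _ fun i _ => ENNReal.toReal_nonneg]
    refine Finset.prod_congr rfl fun i _ => ?_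
    rw [ENNReal.toReal_ofReal (hpos _ _)]
  · simp_rw [integral_gaussLR_rpow _ _ _ hv]
    rw [← Real.exp_sum, Finset.mul_sum, Finset.sum_div]
    simp
end

section
/- (Composition of Rényi differential privacy.) Let k ≥ 1 and for each i ∈ Fin k let P_i and Q_i be probability measures on a measurable space Ω_i with P_i absolutely continuous w.r.t. Q_i, let α > 1 be real, and suppose ∫ (dP_i/dQ_i)^α dQ_i ≤ exp((α − 1)ρ_i) for reals ρ_i ≥ 0. Then the product measures P = ⊗_i P_i and Q = ⊗_i Q_i on Π_i Ω_i satisfy P ≪ Q and ∫ (dP/dQ)^α dQ ≤ exp((α − 1) Σ_i ρ_i); that is, if each mechanism satisfies (α, ρ_i)-RDP then their composition satisfies (α, Σ_i ρ_i)-RDP. -/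
open MeasureTheory

theorem pi_eq_withDensity_aux {k : ℕ} {Ω : Fin k → Type*}
    [∀ i, MeasurableSpace (Ω i)]
    (P Q : ∀ i, Measure (Ω i))
    [∀ i, IsProbabilityMeasure (P i)] [∀ i, IsProbabilityMeasure (Q i)]
    (hac : ∀ i, P i ≪ Q i) :
    Measure.pi P = (Measure.pi Q).withDensity
      (fun x => ∏ i, (P i).rnDeriv (Q i) (x i)) := by
  refine Measure.pi_eq (fun s hs => ?_)
  rw [withDensity_apply _ (MeasurableSet.univ_pi hs),
    ← lintegral_indicator (MeasurableSet.univ_pi hs)]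
  have h1 : (Set.univ.pi s).indicator (fun x => ∏ i, (P i).rnDeriv (Q i) (x i))
      = fun x => ∏ i, (s i).indicator ((P i).rnDeriv (Q i)) (x i) := by
    funext x
    by_cases hx : x ∈ Set.univ.pi s
    · rw [Set.indicator_of_mem hx]
      exact Finset.prod_congr rfl fun i _ =>
        (Set.indicator_of_mem (hx i (Set.mem_univ i)) _).symm
    · rw [Set.indicator_of_notMem hx]
      simp only [Set.mem_univ_pi, not_forall] at hx
      obtain ⟨i, hi⟩ := hx
      exact (Finset.prod_eq_zero (Finset.mem_univ i) (Set.indicator_of_notMem hi _)).symm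
  have hm : ∀ i, Measurable ((s i).indicator ((P i).rnDeriv (Q i))) := fun i =>
    (Measure.measurable_rnDeriv _ _).indicator (hs i)
  rw [h1]
  have h2 := ProbabilityTheory.lintegral_prod_eq_prod_lintegral_of_indepFun
    (μ := Measure.pi Q) Finset.univ
    (fun i (x : ∀ i, Ω i) => (s i).indicator ((P i).rnDeriv (Q i)) (x i))
    (ProbabilityTheory.iIndepFun_pi (fun i => (hm i).aemeasurable))
    (fun i => (hm i).comp (measurable_pi_apply i))
  rw [h2]
  refine Finset.prod_congr rfl fun i _ => ?_
  rw [(measurePreserving_eval Q i).lintegral_comp (hm i), lintegral_indicator (hs i),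
    Measure.setLIntegral_rnDeriv (hac i)]



/-- Composition of Rényi differential privacy: if each `P i` satisfies the
`(α, ρ i)`-Rényi bound w.r.t. `Q i`, then the product measure `⊗_i P i`
is absolutely continuous w.r.t. `⊗_i Q i` and satisfies the
`(α, Σ_i ρ i)`-Rényi bound. -/
theorem rdp_composition {k : ℕ} (hk : 1 ≤ k) {Ω : Fin k → Type*}
    [∀ i, MeasurableSpace (Ω i)]
    (P Q : ∀ i, Measure (Ω i))
    [∀ i, IsProbabilityMeasure (P i)] [∀ i, IsProbabilityMeasure (Q i)]
    (hac : ∀ i, P i ≪ Q i)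
    (α : ℝ) (hα : 1 < α) (ρ : Fin k → ℝ) (hρ : ∀ i, 0 ≤ ρ i)
    (hbound : ∀ i, ∫ x, (((P i).rnDeriv (Q i)) x).toReal ^ α ∂(Q i)
      ≤ Real.exp ((α - 1) * ρ i)) :
    Measure.pi P ≪ Measure.pi Q ∧
      ∫ x, (((Measure.pi P).rnDeriv (Measure.pi Q)) x).toReal ^ α ∂(Measure.pi Q)
        ≤ Real.exp ((α - 1) * ∑ i, ρ i) := by
  have hP := pi_eq_withDensity_aux P Q hac
  have hm : Measurable (fun x : ∀ i, Ω i => ∏ i, (P i).rnDeriv (Q i) (x i)) :=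
    Finset.measurable_prod _ fun i _ =>
      (Measure.measurable_rnDeriv _ _).comp (measurable_pi_apply i)
  refine ⟨hP ▸ withDensity_absolutelyContinuous _ _, ?_⟩
  have hae : (Measure.pi P).rnDeriv (Measure.pi Q) =ᵐ[Measure.pi Q]
      fun x => ∏ i, (P i).rnDeriv (Q i) (x i) := by
    rw [hP]
    exact Measure.rnDeriv_withDensity _ hm
  have h1 : ∫ x, (((Measure.pi P).rnDeriv (Measure.pi Q)) x).toReal ^ α ∂(Measure.pi Q)
      = ∫ x, ∏ i, ((P i).rnDeriv (Q i) (x i)).toReal ^ α ∂(Measure.pi Q) := by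
    refine integral_congr_ae ?_
    filter_upwards [hae] with x hx
    rw [hx, ENNReal.toReal_prod, Real.finsetProd_rpow _ _ fun i _ => ENNReal.toReal_nonneg]
  rw [h1, integral_fintype_prod_eq_prod (fun i y => ((P i).rnDeriv (Q i) y).toReal ^ α),
    Finset.mul_sum, Real.exp_sum]
  exact Finset.prod_le_prod
    (fun i _ => integral_nonneg fun y => Real.rpow_nonneg ENNReal.toReal_nonneg _)
    (fun i _ => hbound i)
end

section
/- (DP guarantee for the one-dimensional Gaussian mechanism via RDP.) Let σ > 0, Δ ≥ 0, and μ, μ' ∈ ℝ with |μ − μ'| ≤ Δ. Let α > 1 be real and δ ∈ (0,1), and set ε = αΔ²/(2σ²) + log(1/δ)/(α − 1). Then for every measurable set S ⊆ ℝ, (gaussianReal μ σ²)(S) ≤ e^ε · (gaussianReal μ' σ²)(S) + δ; that is, the Gaussian mechanism with noise variance σ² applied to a query of sensitivity Δ is (ε, δ)-differentially private. -/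
open MeasureTheory ProbabilityTheory

/-- DP guarantee for the one-dimensional Gaussian mechanism via RDP: for a query
of sensitivity `Δ ≥ |μ − μ'|` and noise variance `σ²`, with
`ε = αΔ²/(2σ²) + log(1/δ)/(α−1)`, the Gaussian output distributions are
`(ε, δ)`-indistinguishable. -/
theorem gaussian_mechanism_dp (σ : NNReal) (hσ : 0 < σ) (Δ : ℝ) (hΔ : 0 ≤ Δ)
    (μ μ' : ℝ) (hsens : |μ - μ'| ≤ Δ) (α : ℝ) (hα : 1 < α)
    (δ : ℝ) (hδ : δ ∈ Set.Ioo (0 : ℝ) 1) (ε : ℝ)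
    (hε : ε = α * Δ ^ 2 / (2 * (σ : ℝ) ^ 2) + Real.log (1 / δ) / (α - 1)) :
    ∀ S : Set ℝ, MeasurableSet S →
      ((gaussianReal μ (σ ^ 2)) S).toReal
        ≤ Real.exp ε * ((gaussianReal μ' (σ ^ 2)) S).toReal + δ := by
  intro S hS
  obtain ⟨hδ0, hδ1⟩ := hδ
  have hs : (0:ℝ) < (σ:ℝ) := by exact_mod_cast hσ
  have hv : σ ^ 2 ≠ 0 := by positivity
  have hd : (μ - μ') ^ 2 ≤ Δ ^ 2 := by
    rw [← sq_abs (μ - μ')]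
    exact pow_le_pow_left₀ (abs_nonneg _) hsens 2
  have hα1 : 0 < α - 1 := by linarith
  have hε' : (α - 1) * ε + Real.log δ = α * (α - 1) * Δ ^ 2 / (2 * (σ : ℝ) ^ 2) := by
    rw [hε, one_div, Real.log_inv]
    field_simp
    ring
  have hmono : α * (α - 1) * (μ - μ') ^ 2 / (2 * (σ : ℝ) ^ 2)
      ≤ α * (α - 1) * Δ ^ 2 / (2 * (σ : ℝ) ^ 2) := by
    have : 0 ≤ α * (α - 1) := by nlinarith
    gcongr
  set ν := α * μ + (1 - α) * μ' with hν
  have key : ∀ x, gaussianPDFReal μ (σ ^ 2) x ≤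
      Real.exp ε * gaussianPDFReal μ' (σ ^ 2) x + δ * gaussianPDFReal ν (σ ^ 2) x := by
    intro x
    simp only [gaussianPDFReal, NNReal.coe_pow]
    set c := (√(2 * Real.pi * (σ:ℝ) ^ 2))⁻¹ with hc
    have hc0 : 0 ≤ c := by positivity
    set A := -(x - μ) ^ 2 / (2 * (σ:ℝ) ^ 2) with hA
    set B := -(x - μ') ^ 2 / (2 * (σ:ℝ) ^ 2) with hB
    set C := -(x - ν) ^ 2 / (2 * (σ:ℝ) ^ 2) with hC
    have hid : C + α * (α - 1) * (μ - μ') ^ 2 / (2 * (σ : ℝ) ^ 2) = α * A + (1 - α) * B := by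
      rw [hA, hB, hC, hν]
      field_simp
      ring
    have h : Real.exp A ≤ Real.exp ε * Real.exp B + δ * Real.exp C := by
      by_cases hle : A ≤ ε + B
      · have h1 := Real.exp_le_exp.mpr hle
        rw [Real.exp_add] at h1
        have : 0 ≤ δ * Real.exp C := by positivity
        linarith
      · have h2 : A ≤ Real.log δ + C := by
          have : 0 ≤ (α - 1) * (A - (ε + B)) := mul_nonneg hα1.le (by linarith)
          nlinarith
        have h1 := Real.exp_le_exp.mpr h2
        rw [Real.exp_add, Real.exp_log hδ0] at h1
        have : 0 ≤ Real.exp ε * Real.exp B := by positivity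
        linarith
    calc c * Real.exp A ≤ c * (Real.exp ε * Real.exp B + δ * Real.exp C) := by gcongr
      _ = _ := by ring
  have hr : ∀ m, ((gaussianReal m (σ ^ 2)) S).toReal = ∫ x in S, gaussianPDFReal m (σ ^ 2) x := by
    intro m
    rw [gaussianReal_apply_eq_integral m hv, ENNReal.toReal_ofReal]
    exact integral_nonneg fun x => gaussianPDFReal_nonneg _ _ _
  have hi : ∀ m, IntegrableOn (gaussianPDFReal m (σ ^ 2)) S := fun m =>
    (integrable_gaussianPDFReal m _).integrableOn
  have h1 : ((gaussianReal ν (σ ^ 2)) S).toReal ≤ 1 :=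
    ENNReal.toReal_le_of_le_ofReal zero_le_one (by simpa using prob_le_one)
  have h2 : ((gaussianReal μ (σ ^ 2)) S).toReal ≤
      Real.exp ε * ((gaussianReal μ' (σ ^ 2)) S).toReal
        + δ * ((gaussianReal ν (σ ^ 2)) S).toReal := by
    rw [hr, hr, hr, ← integral_const_mul, ← integral_const_mul,
      ← integral_add ((hi μ').const_mul _) ((hi ν).const_mul _)]
    exact integral_mono (hi μ) (((hi μ').const_mul _).add ((hi ν).const_mul _)) key
  nlinarith
end

section
/- (Episode-level DP for T composed Gaussian mechanisms.) Let T ≥ 1, σ > 0, Δ ≥ 0, and μ, μ' : Fin T → ℝ with |μ t − μ' t| ≤ Δ for every t. Let α > 1 be real and δ ∈ (0,1), and set ε = T·αΔ²/(2σ²) + log(1/δ)/(α − 1). Let P be the product measure on ℝ^T whose t-th factor is gaussianReal (μ t) σ² and Q the product measure whose t-th factor is gaussianReal (μ' t) σ². Then for every measurable set S ⊆ ℝ^T, P(S) ≤ e^ε · Q(S) + δ; that is, the T-fold composition of Gaussian mechanisms each with sensitivity Δ and noise variance σ² is (ε, δ)-differentially private. -/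
open MeasureTheory ProbabilityTheory

lemma aux_lintegral_pi {n : ℕ} (μ : Fin n → Measure ℝ) [∀ i, SigmaFinite (μ i)]
    (f : Fin n → ℝ → ℝ) (hf : ∀ i, Integrable (f i) (μ i)) (h0 : ∀ i x, 0 ≤ f i x) :
    ∫⁻ x, ENNReal.ofReal (∏ i, f i (x i)) ∂(Measure.pi μ)
      = ∏ i, ∫⁻ x, ENNReal.ofReal (f i x) ∂(μ i) := by
  rw [← ofReal_integral_eq_lintegral_ofReal (Integrable.fintype_prod hf)
    (Filter.Eventually.of_forall fun x => Finset.prod_nonneg fun i _ => h0 i _),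
    integral_fintype_prod_eq_prod, ENNReal.ofReal_prod_of_nonneg
      (fun i _ => integral_nonneg (h0 i))]
  refine Finset.prod_congr rfl fun i _ => ?_
  rw [ofReal_integral_eq_lintegral_ofReal (hf i) (Filter.Eventually.of_forall (h0 i))]

/-- log-likelihood ratio of two Gaussians with equal variance -/
noncomputable def llrG (m m' v x : ℝ) : ℝ := (m - m') / v * x + (m' ^ 2 - m ^ 2) / (2 * v)

lemma measurable_llrG (m m' v : ℝ) : Measurable (llrG m m' v) := by
  unfold llrG; fun_prop

lemma aux_density (m m' : ℝ) (v : NNReal) (hv : v ≠ 0) :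
    gaussianReal m v = (gaussianReal m' v).withDensity
      (fun x => ENNReal.ofReal (Real.exp (llrG m m' v x))) := by
  rw [gaussianReal_of_var_ne_zero m hv, gaussianReal_of_var_ne_zero m' hv,
    ← withDensity_mul _ (measurable_gaussianPDF _ _)
      (measurable_llrG m m' v).exp.ennreal_ofReal]
  congr 1
  funext x
  have hv' : (v : ℝ) ≠ 0 := by exact_mod_cast hv
  simp only [Pi.mul_apply, gaussianPDF]
  rw [← ENNReal.ofReal_mul (gaussianPDFReal_nonneg _ _ _)]
  congr 1
  simp only [gaussianPDFReal, llrG]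
  rw [mul_assoc (Inv.inv _), ← Real.exp_add]
  congr 2
  field_simp
  ring

lemma aux_exp_eq (m m' v c : ℝ) :
    (fun x => Real.exp (c * llrG m m' v x))
      = fun x => Real.exp (c * ((m - m') / v) * x) * Real.exp (c * ((m' ^ 2 - m ^ 2) / (2 * v))) := by
  funext x
  rw [← Real.exp_add, llrG]
  congr 1; ring

lemma aux_integrable (a m m' : ℝ) (v : NNReal) (c : ℝ) :
    Integrable (fun x => Real.exp (c * llrG m m' v x)) (gaussianReal a v) := by
  rw [aux_exp_eq]
  exact (integrable_exp_mul_gaussianReal _).mul_const _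

lemma aux_mgf (m m' : ℝ) (v : NNReal) (hv : v ≠ 0) (c : ℝ) :
    ∫ x, Real.exp (c * llrG m m' v x) ∂(gaussianReal m v)
      = Real.exp (c * (c + 1) * (m - m') ^ 2 / (2 * v)) := by
  have hv' : (v : ℝ) ≠ 0 := by exact_mod_cast hv
  rw [aux_exp_eq, integral_mul_const]
  have := congrFun (mgf_id_gaussianReal (μ := m) (v := v)) (c * ((m - m') / v))
  simp only [mgf, id] at this
  rw [this, ← Real.exp_add]
  congr 1
  field_simp
  ring

lemma aux_pi_density {n : ℕ} (m m' : Fin n → ℝ) (v : NNReal) (hv : v ≠ 0) :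
    (Measure.pi fun t => gaussianReal (m t) v)
      = (Measure.pi fun t => gaussianReal (m' t) v).withDensity
        (fun x => ENNReal.ofReal (Real.exp (∑ t, llrG (m t) (m' t) v (x t)))) := by
  refine Measure.pi_eq fun s hs => ?_
  rw [withDensity_apply _ (MeasurableSet.univ_pi hs), Measure.restrict_pi_pi]
  simp_rw [Real.exp_sum]
  rw [aux_lintegral_pi _ (fun t x => Real.exp (llrG (m t) (m' t) v x)) _
    (fun _ _ => (Real.exp_pos _).le)]
  · refine Finset.prod_congr rfl fun i _ => ?_
    rw [aux_density (m i) (m' i) v hv, withDensity_apply _ (hs i)]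
  · intro i
    have := aux_integrable (m' i) (m i) (m' i) v 1
    simp only [one_mul] at this
    exact this.restrict

/-- Episode-level DP for `T` composed Gaussian mechanisms: if `|μ t − μ' t| ≤ Δ`
for all `t` and `ε = TαΔ²/(2σ²) + log(1/δ)/(α−1)`, then the product Gaussian
measures are `(ε, δ)`-indistinguishable. -/
theorem gaussian_composition_dp (T : ℕ) (hT : 1 ≤ T) (σ : NNReal) (hσ : 0 < σ)
    (Δ : ℝ) (hΔ : 0 ≤ Δ) (μ μ' : Fin T → ℝ) (hsens : ∀ t, |μ t - μ' t| ≤ Δ)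
    (α : ℝ) (hα : 1 < α) (δ : ℝ) (hδ : δ ∈ Set.Ioo (0 : ℝ) 1) (ε : ℝ)
    (hε : ε = (T : ℝ) * α * Δ ^ 2 / (2 * (σ : ℝ) ^ 2) + Real.log (1 / δ) / (α - 1)) :
    ∀ S : Set (Fin T → ℝ), MeasurableSet S →
      ((Measure.pi fun t => gaussianReal (μ t) (σ ^ 2)) S).toReal
        ≤ Real.exp ε * ((Measure.pi fun t => gaussianReal (μ' t) (σ ^ 2)) S).toReal + δ := by
  intro S hS
  obtain ⟨hδ0, hδ1⟩ := hδ
  have hv : σ ^ 2 ≠ 0 := pow_ne_zero _ hσ.ne'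
  have hσ' : (0 : ℝ) < σ := by exact_mod_cast hσ
  set P := Measure.pi fun t => gaussianReal (μ t) (σ ^ 2) with hP
  set Q := Measure.pi fun t => gaussianReal (μ' t) (σ ^ 2) with hQ
  set L : (Fin T → ℝ) → ℝ := fun x => ∑ t, llrG (μ t) (μ' t) ((σ ^ 2 : NNReal) : ℝ) (x t) with hL
  have hLm : Measurable L := by
    refine Finset.measurable_sum _ fun t _ => ?_
    exact (measurable_llrG _ _ _).comp (measurable_pi_apply t)
  have hPQ : P = Q.withDensity (fun x => ENNReal.ofReal (Real.exp (L x))) :=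
    aux_pi_density μ μ' (σ ^ 2) hv
  have hα' : 0 < α - 1 := by linarith
  have hexp : ∀ x : Fin T → ℝ, Real.exp ((α - 1) * L x)
      = ∏ t, Real.exp ((α - 1) * llrG (μ t) (μ' t) ((σ ^ 2 : NNReal) : ℝ) (x t)) := by
    intro x
    rw [← Real.exp_sum, hL, Finset.mul_sum]
  -- the tail
  have htail : P.real {x | ε ≤ L x} ≤ δ := by
    have hint : Integrable (fun x => Real.exp ((α - 1) * L x)) P := by
      simp_rw [hexp]
      exact Integrable.fintype_prod
        (f := fun t x => Real.exp ((α - 1) * llrG (μ t) (μ' t) ((σ ^ 2 : NNReal) : ℝ) x))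
        (fun t => aux_integrable _ _ _ _ _)
    refine (measure_ge_le_exp_mul_mgf ε hα'.le hint).trans ?_
    have hm : mgf L P (α - 1)
        = Real.exp (∑ t, (α - 1) * (α - 1 + 1) * (μ t - μ' t) ^ 2 / (2 * ((σ ^ 2 : NNReal) : ℝ))) := by
      simp only [mgf]
      simp_rw [hexp]
      rw [hP, integral_fintype_prod_eq_prod
        (f := fun t x => Real.exp ((α - 1) * llrG (μ t) (μ' t) ((σ ^ 2 : NNReal) : ℝ) x)),
        Real.exp_sum]
      exact Finset.prod_congr rfl fun t _ => aux_mgf _ _ _ hv _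
    rw [hm, ← Real.exp_add]
    have hs : ∑ t, (α - 1) * (α - 1 + 1) * (μ t - μ' t) ^ 2 / (2 * ((σ ^ 2 : NNReal) : ℝ))
        ≤ ∑ _t : Fin T, (α - 1) * α * Δ ^ 2 / (2 * (σ : ℝ) ^ 2) := by
      refine Finset.sum_le_sum fun t _ => ?_
      have h2 : (μ t - μ' t) ^ 2 ≤ Δ ^ 2 := by
        rw [← sq_abs]
        exact pow_le_pow_left₀ (abs_nonneg _) (hsens t) 2
      push_cast
      rw [sub_add_cancel]
      have : 0 ≤ (α - 1) * α := by nlinarith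
      gcongr
    rw [Finset.sum_const, Finset.card_univ, Fintype.card_fin, nsmul_eq_mul] at hs
    have he : -(α - 1) * ε = -((T : ℝ) * ((α - 1) * α * Δ ^ 2 / (2 * (σ : ℝ) ^ 2))) + Real.log δ := by
      rw [hε, one_div, Real.log_inv]
      field_simp
      ring
    calc _ ≤ Real.exp (Real.log δ) := by
          apply Real.exp_le_exp.2
          linarith
      _ = δ := Real.exp_log hδ0
  have hA : MeasurableSet {x | ε ≤ L x} := measurableSet_le measurable_const hLm
  have hmain : P (S \ {x | ε ≤ L x}) ≤ ENNReal.ofReal (Real.exp ε) * Q S := by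
    rw [hPQ, withDensity_apply _ (hS.diff hA)]
    calc _ ≤ ∫⁻ _x in S \ {x | ε ≤ L x}, ENNReal.ofReal (Real.exp ε) ∂Q := by
          refine setLIntegral_mono measurable_const fun x hx => ?_
          have : L x < ε := not_le.1 hx.2
          gcongr
      _ = ENNReal.ofReal (Real.exp ε) * Q (S \ {x | ε ≤ L x}) := setLIntegral_const _ _
      _ ≤ _ := by
          gcongr
          exact Set.diff_subset
  have hmain' : P.real (S \ {x | ε ≤ L x}) ≤ Real.exp ε * Q.real S := by
    have := ENNReal.toReal_mono (ENNReal.mul_ne_top ENNReal.ofReal_ne_top (measure_ne_top Q S)) hmain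
    rwa [ENNReal.toReal_mul, ENNReal.toReal_ofReal (Real.exp_pos _).le] at this
  change P.real S ≤ Real.exp ε * Q.real S + δ
  calc P.real S ≤ P.real ((S \ {x | ε ≤ L x}) ∪ {x | ε ≤ L x}) := by
        refine measureReal_mono ?_
        intro x hx
        by_cases h : ε ≤ L x
        · exact Or.inr h
        · exact Or.inl ⟨hx, h⟩
    _ ≤ _ := measureReal_union_le _ _
    _ ≤ _ := add_le_add hmain' htail
end

section
/- (Existence of a pure Nash equilibrium in two-player potential games on [0,1]², Monderer–Shapley.) Let u₁, u₂ : ℝ × ℝ → ℝ and Φ : ℝ × ℝ → ℝ be continuous on [0,1] × [0,1], and suppose Φ is an exact potential for (u₁, u₂) on [0,1]². Then the game has at least one pure-strategy Nash equilibrium: there exists (p₁*, p₂*) ∈ [0,1] × [0,1] such that u₁(p₁, p₂*) ≤ u₁(p₁*, p₂*) for all p₁ ∈ [0,1] and u₂(p₁*, p₂) ≤ u₂(p₁*, p₂*) for all p₂ ∈ [0,1]. -/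
/-- Existence of a pure-strategy Nash equilibrium in a two-player potential game
on `[0,1]²` (Monderer–Shapley): if `Φ` is an exact potential for `(u₁, u₂)` on
`[0,1]²` and `u₁, u₂, Φ` are continuous on `[0,1]²`, then there exists a
pure-strategy Nash equilibrium. -/
theorem potential_game_has_nash (u₁ u₂ Φ : ℝ × ℝ → ℝ)
    (hu₁ : ContinuousOn u₁ (Set.Icc (0 : ℝ) 1 ×ˢ Set.Icc (0 : ℝ) 1))
    (hu₂ : ContinuousOn u₂ (Set.Icc (0 : ℝ) 1 ×ˢ Set.Icc (0 : ℝ) 1))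
    (hΦ : ContinuousOn Φ (Set.Icc (0 : ℝ) 1 ×ˢ Set.Icc (0 : ℝ) 1))
    (hpot : ∀ a ∈ Set.Icc (0 : ℝ) 1, ∀ b ∈ Set.Icc (0 : ℝ) 1, ∀ c ∈ Set.Icc (0 : ℝ) 1,
      u₁ (a, c) - u₁ (b, c) = Φ (a, c) - Φ (b, c) ∧
      u₂ (c, a) - u₂ (c, b) = Φ (c, a) - Φ (c, b)) :
    ∃ p ∈ Set.Icc (0 : ℝ) 1 ×ˢ Set.Icc (0 : ℝ) 1,
      (∀ p₁ ∈ Set.Icc (0 : ℝ) 1, u₁ (p₁, p.2) ≤ u₁ p) ∧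
      (∀ p₂ ∈ Set.Icc (0 : ℝ) 1, u₂ (p.1, p₂) ≤ u₂ p) := by
  obtain ⟨⟨x, y⟩, ⟨hx, hy⟩, hmax⟩ := (isCompact_Icc.prod isCompact_Icc).exists_isMaxOn
    (⟨(0, 0), by simp⟩ : (Set.Icc (0 : ℝ) 1 ×ˢ Set.Icc (0 : ℝ) 1).Nonempty) hΦ
  refine ⟨(x, y), ⟨hx, hy⟩, fun a ha => ?_, fun b hb => ?_⟩
  · have h1 := (hpot a ha x hx y hy).1
    have h2 : Φ (a, y) ≤ Φ (x, y) := hmax (Set.mk_mem_prod ha hy)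
    show u₁ (a, y) ≤ u₁ (x, y)
    linarith
  · have h1 := (hpot b hb y hy x hx).2
    have h2 : Φ (x, b) ≤ Φ (x, y) := hmax (Set.mk_mem_prod hx hb)
    show u₂ (x, b) ≤ u₂ (x, y)
    linarith
end

section
/- (Potential function from equal mixed partial derivatives.) Let u₁, u₂ : ℝ × ℝ → ℝ be twice continuously differentiable and suppose that their mixed second-order partial derivatives agree everywhere: ∂²u₁/∂p₁∂p₂ = ∂²u₂/∂p₁∂p₂ on ℝ². Then there exists a continuously differentiable function Φ : ℝ × ℝ → ℝ such that u₁(a,c) − u₁(b,c) = Φ(a,c) − Φ(b,c) and u₂(c,a) − u₂(c,b) = Φ(c,a) − Φ(c,b) for all a, b, c ∈ ℝ; that is, the two-player game (u₁, u₂) is a potential game. -/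
lemma aux_diff_partial (u : ℝ × ℝ → ℝ) (h : ContDiff ℝ 2 u) (b : ℝ) :
    Differentiable ℝ (fun x => deriv (fun y => u (x, y)) b) := by
  have hd : Differentiable ℝ u := h.differentiable (by norm_num)
  have e : (fun x => deriv (fun y => u (x, y)) b)
      = fun x : ℝ => fderiv ℝ u (x, b) ((0 : ℝ), (1 : ℝ)) := by
    funext x
    have h1 : HasDerivAt (fun y : ℝ => (x, y)) ((0 : ℝ), (1 : ℝ)) b :=
      (hasDerivAt_const b x).prodMk (hasDerivAt_id b)
    exact ((hd (x, b)).hasFDerivAt.comp_hasDerivAt b h1).deriv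
  rw [e]
  have h2 : Differentiable ℝ (fderiv ℝ u) :=
    (h.fderiv_right (m := 1) (by norm_num)).differentiable (by norm_num)
  have h3 : Differentiable ℝ (fun x : ℝ => fderiv ℝ u (x, b)) :=
    h2.comp (by fun_prop : Differentiable ℝ (fun x : ℝ => (x, b)))
  exact h3.clm_apply (differentiable_const _)

/-- If two `C²` utility functions on `ℝ²` have equal mixed second-order partial
derivatives everywhere, then the two-player game `(u₁, u₂)` admits a `C¹` exact
potential function `Φ`. -/
theorem equal_mixed_partials_gives_potential (u₁ u₂ : ℝ × ℝ → ℝ)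
    (h₁ : ContDiff ℝ 2 u₁) (h₂ : ContDiff ℝ 2 u₂)
    (hmixed : ∀ a b : ℝ,
      deriv (fun x => deriv (fun y => u₁ (x, y)) b) a
        = deriv (fun x => deriv (fun y => u₂ (x, y)) b) a) :
    ∃ Φ : ℝ × ℝ → ℝ, ContDiff ℝ 1 Φ ∧
      ∀ a b c : ℝ,
        u₁ (a, c) - u₁ (b, c) = Φ (a, c) - Φ (b, c) ∧
        u₂ (c, a) - u₂ (c, b) = Φ (c, a) - Φ (c, b) := by
  have hd₁ : Differentiable ℝ u₁ := h₁.differentiable (by norm_num)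
  have hd₂ : Differentiable ℝ u₂ := h₂.differentiable (by norm_num)
  have s₁ : ∀ x : ℝ, Differentiable ℝ (fun y => u₁ (x, y)) := fun x =>
    hd₁.comp (by fun_prop : Differentiable ℝ (fun y : ℝ => (x, y)))
  have s₂ : ∀ x : ℝ, Differentiable ℝ (fun y => u₂ (x, y)) := fun x =>
    hd₂.comp (by fun_prop : Differentiable ℝ (fun y : ℝ => (x, y)))
  have k1 : ∀ x b : ℝ, deriv (fun y => u₁ (x, y)) b - deriv (fun y => u₂ (x, y)) b
      = deriv (fun y => u₁ (0, y)) b - deriv (fun y => u₂ (0, y)) b := by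
    intro x b
    have d1 := aux_diff_partial u₁ h₁ b
    have d2 := aux_diff_partial u₂ h₂ b
    refine is_const_of_deriv_eq_zero (𝕜 := ℝ)
      (f := fun x => deriv (fun y => u₁ (x, y)) b - deriv (fun y => u₂ (x, y)) b)
      (d1.sub d2) (fun a => ?_) x 0
    have := ((d1 a).hasDerivAt.sub (d2 a).hasDerivAt).deriv
    rw [hmixed a b, sub_self] at this
    exact this
  have k2 : ∀ x a b : ℝ, (u₁ (x, a) - u₂ (x, a)) - (u₁ (0, a) - u₂ (0, a))
      = (u₁ (x, b) - u₂ (x, b)) - (u₁ (0, b) - u₂ (0, b)) := by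
    intro x a b
    refine is_const_of_deriv_eq_zero (𝕜 := ℝ)
      (f := fun y => (u₁ (x, y) - u₂ (x, y)) - (u₁ (0, y) - u₂ (0, y)))
      (((s₁ x).sub (s₂ x)).sub ((s₁ 0).sub (s₂ 0))) (fun y => ?_) a b
    have := ((((s₁ x) y).hasDerivAt.sub ((s₂ x) y).hasDerivAt).sub
      (((s₁ 0) y).hasDerivAt.sub ((s₂ 0) y).hasDerivAt)).deriv
    rw [k1 x y, sub_self] at this
    exact this
  refine ⟨fun p => u₁ p - u₁ (0, p.2) + u₂ (0, p.2), ?_, ?_⟩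
  · have g₁ : ContDiff ℝ 1 u₁ := h₁.of_le (by norm_num)
    have g₂ : ContDiff ℝ 1 u₂ := h₂.of_le (by norm_num)
    have g : ContDiff ℝ 1 (fun p : ℝ × ℝ => ((0 : ℝ), p.2)) := by fun_prop
    exact (g₁.sub (g₁.comp g)).add (g₂.comp g)
  · intro a b c
    have := k2 c a b
    constructor
    · simp
    · simp only
      linarith
end

section
/- (Nash equilibrium in single round binary sums.) Let B₁, B₂ > 0 and C₁, C₂ ∈ ℝ with C₁/B₁ = C₂/B₂ = c, and define u_n(p₁, p₂) = −(B_n/2)(p₁ + p₂)² + C_n·p_n + B_n/2 − C_n for n ∈ {1,2}. Then every point (p₁*, p₂*) ∈ [0,1] × [0,1] with p₁* + p₂* = c is a pure-strategy Nash equilibrium of the game with action sets [0,1]: u₁(p₁, p₂*) ≤ u₁(p₁*, p₂*) for all p₁ ∈ [0,1] and u₂(p₁*, p₂) ≤ u₂(p₁*, p₂*) for all p₂ ∈ [0,1]. -/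
/-- Nash equilibrium in single round binary sums: with `C₁/B₁ = C₂/B₂ = c`,
every `(p₁*, p₂*) ∈ [0,1]²` with `p₁* + p₂* = c` is a pure-strategy Nash
equilibrium of the game with utilities
`u_n(p₁,p₂) = −(B_n/2)(p₁+p₂)² + C_n·p_n + B_n/2 − C_n` and action sets `[0,1]`. -/
theorem single_round_binary_sums_nash (B₁ B₂ C₁ C₂ c : ℝ)
    (hB₁ : 0 < B₁) (hB₂ : 0 < B₂) (h₁ : C₁ / B₁ = c) (h₂ : C₂ / B₂ = c)
    (u₁ u₂ : ℝ → ℝ → ℝ)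
    (hu₁ : ∀ p₁ p₂, u₁ p₁ p₂ = -(B₁ / 2) * (p₁ + p₂) ^ 2 + C₁ * p₁ + B₁ / 2 - C₁)
    (hu₂ : ∀ p₁ p₂, u₂ p₁ p₂ = -(B₂ / 2) * (p₁ + p₂) ^ 2 + C₂ * p₂ + B₂ / 2 - C₂)
    (p₁ p₂ : ℝ) (hp₁ : p₁ ∈ Set.Icc (0 : ℝ) 1) (hp₂ : p₂ ∈ Set.Icc (0 : ℝ) 1)
    (hsum : p₁ + p₂ = c) :
    (∀ q₁ ∈ Set.Icc (0 : ℝ) 1, u₁ q₁ p₂ ≤ u₁ p₁ p₂) ∧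
    (∀ q₂ ∈ Set.Icc (0 : ℝ) 1, u₂ p₁ q₂ ≤ u₂ p₁ p₂) := by
  rw [div_eq_iff hB₁.ne'] at h₁
  rw [div_eq_iff hB₂.ne'] at h₂
  subst hsum
  subst h₁
  subst h₂
  constructor
  · intro q _
    rw [hu₁, hu₁]
    nlinarith [mul_nonneg hB₁.le (sq_nonneg (q - p₁))]
  · intro q _
    rw [hu₂, hu₂]
    nlinarith [mul_nonneg hB₂.le (sq_nonneg (q - p₂))]
end
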